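/- Let p be a prime, A an abelian group, n ≥ 1, and 0 ≤ i ≤ n − 1. Let a, a' ∈ A^{⊗p^i} be such that a − a' ∈ p·A^{⊗p^i} (i.e. a − a' = p·x for some x ∈ A^{⊗p^i}). Then the element Σ_{l=0}^{p^i−1} σ_n^l(a^{⊗p^{n−i}}) − Σ_{l=0}^{p^i−1} σ_n^l(a'^{⊗p^{n−i}}) of A^{⊗p^n} lies in the image of the norm map N_{p^n} = Σ_{s=0}^{p^n−1} σ_n^s. -/

import Mathlib

open scoped TensorProduct

section Digits

/-- Identification of digit tuples `(Fin p)^m` (first digit most significant) with `Fin (p^m)`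
via base-`p` digits. -/
def msbEquiv (p m : ℕ) : (Fin m → Fin p) ≃ Fin (p ^ m) :=
  (Equiv.piCongrLeft' (fun _ => Fin p) Fin.revPerm).trans finFunctionFinEquiv

/-- The digit rotation `τ_m : (i_1, …, i_m) ↦ (i_m, i_1, …, i_{m-1})` of digit tuples. -/
def rotPerm (p m : ℕ) [NeZero m] : Equiv.Perm (Fin m → Fin p) :=
  Equiv.piCongrLeft' (fun _ => Fin p) (Equiv.addRight (1 : Fin m))

/-- The permutation of `Fin (p^m)` corresponding to a permutation of digit tuples. -/
def digitPerm (p m : ℕ) (e : Equiv.Perm (Fin m → Fin p)) : Equiv.Perm (Fin (p ^ m)) :=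
  Equiv.permCongr (msbEquiv p m) e

end Digits

noncomputable section Tensor

/-- The `m`-fold tensor power over `ℤ` of an abelian group `A`, indexed by `Fin m`. -/
abbrev Tp (A : Type*) [AddCommGroup A] (m : ℕ) : Type _ := ⨂[ℤ] _ : Fin m, A

/-- The action of a permutation `e` of `Fin m` on the tensor power, by reindexing. -/
def permT (A : Type*) [AddCommGroup A] (m : ℕ) (e : Equiv.Perm (Fin m)) :
    Tp A m ≃ₗ[ℤ] Tp A m :=
  PiTensorProduct.reindex ℤ (fun _ : Fin m => A) e

/-- The cyclic permutation `σ_m` on the tensor power, induced by reindexing along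
`x ↦ x + 1` on `Fin m`, so that `σ(a_1 ⊗ ⋯ ⊗ a_m) = a_m ⊗ a_1 ⊗ ⋯ ⊗ a_{m-1}`. -/
def sigmaT (A : Type*) [AddCommGroup A] (m : ℕ) [NeZero m] : Tp A m ≃ₗ[ℤ] Tp A m :=
  permT A m (Equiv.addRight (1 : Fin m))

/-- The norm (transfer) map `N_m = Σ_{s=0}^{m-1} σ_m^s` on the tensor power. -/
def normT (A : Type*) [AddCommGroup A] (m : ℕ) [NeZero m] : Tp A m → Tp A m :=
  fun x => ∑ s ∈ Finset.range m, (⇑(sigmaT A m))^[s] x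

/-- Identification of tensor powers of equal sizes. -/
def tcast {A : Type*} [AddCommGroup A] {a b : ℕ} (h : a = b) : Tp A a ≃ₗ[ℤ] Tp A b :=
  TensorPower.cast ℤ A h

/-- Flattening of an iterated tensor power: `(A^{⊗N})^{⊗q} ≃ A^{⊗(N·q)}`, grouping
consecutive blocks of length `N`. -/
def flattenE (A : Type*) [AddCommGroup A] (N : ℕ) : (q : ℕ) →
    (⨂[ℤ] _ : Fin q, Tp A N) ≃ₗ[ℤ] Tp A (N * q)
  | 0 => (PiTensorProduct.isEmptyEquiv (Fin 0)).trans
      (PiTensorProduct.isEmptyEquiv (Fin 0)).symm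
  | q + 1 =>
      (TensorPower.mulEquiv (R := ℤ) (M := Tp A N) (n := q) (m := 1)).symm.trans <|
      (TensorProduct.congr (flattenE A N q)
        (PiTensorProduct.subsingletonEquiv (0 : Fin 1))).trans <|
      TensorPower.mulEquiv (R := ℤ) (M := A) (n := N * q) (m := N)

/-- The elementary tensor `c^{⊗B} ∈ A^{⊗(N·B)}` whose `B` consecutive blocks of length `N`
all equal `c ∈ A^{⊗N}`. -/
def tpow {A : Type*} [AddCommGroup A] {N : ℕ} (c : Tp A N) (B : ℕ) : Tp A (N * B) :=
  flattenE A N B (PiTensorProduct.tprod ℤ (fun _ : Fin B => c))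

/-- `c^{⊗B}`, recast to live in `A^{⊗m}` along an identification `N * B = m`. -/
def tpowTo {A : Type*} [AddCommGroup A] {N : ℕ} (c : Tp A N) (B : ℕ) {m : ℕ}
    (h : N * B = m) : Tp A m :=
  tcast (A := A) h (tpow c B)

end Tensor

/-- If the invariant weight `c` is divisible by the order of every stabilizer, the `c`-weighted sum
of `v` is a norm, with coefficients supported on orbit representatives. -/
lemma exists_sum_vadd_eq {G X V : Type*} [AddGroup G] [Fintype G] [Fintype X] [AddAction G X]
    [AddCommGroup V] (c : X → ℕ) (hc : ∀ (g : G) (x : X), c (g +ᵥ x) = c x)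
    (hdvd : ∀ x : X, Nat.card (AddAction.stabilizer G x) ∣ c x) (v : X → V) :
    ∃ d : X → ℕ, ∑ g : G, ∑ x : X, d x • v (g +ᵥ x) = ∑ x : X, c x • v x := by
  classical
  let Ω := AddAction.orbitRel.Quotient G X
  let π : X → Ω := Quotient.mk _
  have hfib : ∀ (g : G) (x₀ : X), (Finset.univ.filter fun h : G => h +ᵥ x₀ = g +ᵥ x₀).card
      = Nat.card (AddAction.stabilizer G (x₀ : X)) := by
    intro g x₀
    rw [← Fintype.card_subtype, ← Nat.card_eq_fintype_card]
    refine Nat.card_congr ((Equiv.addLeft (-g)).subtypeEquiv fun h => ?_)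
    simp [AddAction.mem_stabilizer_iff, add_vadd, neg_vadd_eq_iff]
  have horb : ∀ x₀ : X, ∑ g : G, v (g +ᵥ x₀)
      = Nat.card (AddAction.stabilizer G x₀)
        • ∑ x ∈ Finset.univ.filter (fun x => π x = π x₀), v x := by
    intro x₀
    rw [← Finset.sum_fiberwise_of_maps_to
      (s := Finset.univ) (t := Finset.univ.filter fun x => π x = π x₀) (g := fun g : G => g +ᵥ x₀)]
    · rw [Finset.smul_sum]
      refine Finset.sum_congr rfl fun x hx => ?_
      obtain ⟨g, rfl⟩ : ∃ g : G, g +ᵥ x₀ = x := by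
        have := Quotient.exact (Finset.mem_filter.1 hx).2
        exact this
      rw [Finset.sum_congr rfl (g := fun _ => v (g +ᵥ x₀)), Finset.sum_const, hfib]
      intro h hh
      rw [(Finset.mem_filter.1 hh).2]
    · intro g _
      simp only [Finset.mem_filter, Finset.mem_univ, true_and]
      exact Quotient.sound ⟨g, rfl⟩
  refine ⟨fun x => if (π x).out = x then c x / Nat.card (AddAction.stabilizer G x) else 0, ?_⟩
  rw [Finset.sum_comm, ← Finset.sum_fiberwise (s := Finset.univ) (g := π),
    ← Finset.sum_fiberwise (s := Finset.univ) (g := π) (f := fun x => c x • v x)]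
  refine Finset.sum_congr rfl fun q _ => ?_
  have hq : π q.out = q := Quotient.out_eq q
  rw [Finset.sum_eq_single q.out]
  · simp only [hq, if_true]
    rw [← Finset.smul_sum, horb, smul_smul, Nat.div_mul_cancel (hdvd _), Finset.smul_sum, hq]
    refine Finset.sum_congr rfl fun x hx => ?_
    obtain ⟨g, rfl⟩ : ∃ g : G, g +ᵥ q.out = x := by
      have := Quotient.exact ((Finset.mem_filter.1 hx).2.trans hq.symm)
      exact this
    rw [hc]
  · intro x hx hne
    have : ¬ (π x).out = x := by
      rw [(Finset.mem_filter.1 hx).2]; exact hne.symm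
    simp [this]
  · intro h
    simp [hq] at h

open scoped Pointwise in
lemma card_stabilizer_dvd_pow_card {G : Type*} [AddGroup G] [Fintype G] [DecidableEq G] {p k : ℕ}
    (hp : p.Prime) (hG : Nat.card G = p ^ k) (S : Finset G) (hS : S.Nonempty) :
    Nat.card (AddAction.stabilizer G S) ∣ p ^ S.card := by
  obtain ⟨x, hx⟩ := hS
  have hle : Nat.card (AddAction.stabilizer G S) ≤ S.card := by
    rw [← Nat.card_eq_finsetCard S]
    refine Nat.card_le_card_of_injective
      (fun h : AddAction.stabilizer G S => (⟨h.1 + x, ?_⟩ : S)) ?_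
    · have := Finset.vadd_mem_vadd_finset (a := h.1) hx
      rw [h.2] at this
      exact this
    · intro g h hgh
      exact Subtype.ext (add_right_cancel (congrArg Subtype.val hgh))
  obtain ⟨j, -, hj⟩ := (Nat.dvd_prime_pow hp).1
    (hG ▸ AddSubgroup.card_addSubgroup_dvd_card (AddAction.stabilizer G S))
  rw [hj] at hle ⊢
  exact pow_dvd_pow _ ((Nat.lt_pow_self hp.one_lt).le.trans hle)

/-- Flattening concatenates consecutive blocks of a sequence. -/
lemma flattenE_tprod {A : Type*} [AddCommGroup A] (N q : ℕ) (f : ℕ → A) :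
    flattenE A N q (PiTensorProduct.tprod ℤ fun b : Fin q =>
      PiTensorProduct.tprod ℤ fun r : Fin N => f (N * b + r))
      = PiTensorProduct.tprod ℤ fun j : Fin (N * q) => f j := by
  induction q with
  | zero =>
    simp only [flattenE, LinearEquiv.trans_apply, PiTensorProduct.isEmptyEquiv_apply_tprod]
    rw [LinearEquiv.symm_apply_eq, PiTensorProduct.isEmptyEquiv_apply_tprod]
  | succ q ih =>
    have hmul : ∀ (M : Type _) [AddCommGroup M] (a b : ℕ) (u : Fin a → M) (w : Fin b → M),
        TensorPower.mulEquiv (R := ℤ) (PiTensorProduct.tprod ℤ u ⊗ₜ PiTensorProduct.tprod ℤ w)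
          = PiTensorProduct.tprod ℤ (Fin.append u w) :=
      fun M _ a b u w => TensorPower.tprod_mul_tprod ℤ u w
    have hsplit : (PiTensorProduct.tprod ℤ fun b : Fin (q + 1) =>
      PiTensorProduct.tprod ℤ fun r : Fin N => f (N * b + r)) =
      TensorPower.mulEquiv (R := ℤ) (PiTensorProduct.tprod ℤ (fun b : Fin q =>
        PiTensorProduct.tprod ℤ fun r : Fin N => f (N * b + r)) ⊗ₜ PiTensorProduct.tprod ℤ
          (fun b : Fin 1 => PiTensorProduct.tprod ℤ fun r : Fin N => f (N * q + r))) := by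
      rw [hmul]
      congr 1
      funext b
      refine Fin.addCases (fun b => ?_) (fun b => ?_) b
      · rw [Fin.append_left, Fin.val_castAdd]
      · rw [Fin.append_right, Fin.val_natAdd, Fin.val_eq_zero, add_zero]
    simp only [flattenE, LinearEquiv.trans_apply]
    rw [hsplit, LinearEquiv.symm_apply_apply, TensorProduct.congr_tmul, ih,
      PiTensorProduct.subsingletonEquiv_apply_tprod, hmul]
    congr 1
    funext b
    refine Fin.addCases (m := N * q) (n := N) (fun b => ?_) (fun b => ?_) b
    · simp
    · simp

lemma iterate_sigmaT_tprod {A : Type*} [AddCommGroup A] (m : ℕ) [NeZero m] (s : ℕ)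
    (f : ℕ → A) (hf : Function.Periodic f m) (t : ℕ) (hst : m ∣ s + t) :
    (⇑(sigmaT A m))^[s] (PiTensorProduct.tprod ℤ fun j : Fin m => f j)
      = PiTensorProduct.tprod ℤ fun j : Fin m => f (j + t) := by
  induction s generalizing t with
  | zero =>
    obtain ⟨e, he⟩ := hst
    rw [zero_add] at he
    subst he
    simp only [Function.iterate_zero, id_eq, mul_comm m e, ← smul_eq_mul, hf.nsmul e _]
  | succ s ih =>
    rw [Function.iterate_succ_apply', ih (t + 1) (by convert hst using 1; ring), sigmaT, permT,
      PiTensorProduct.reindex_tprod]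
    congr 1
    funext j
    obtain ⟨j, rfl⟩ := (Equiv.addRight (1 : Fin m)).surjective j
    rw [Equiv.symm_apply_apply, Equiv.coe_addRight, Fin.val_add, Fin.val_one',
      Nat.add_mod_mod, ← hf.map_mod_nat (_ + t), Nat.mod_add_mod, hf.map_mod_nat]
    congr 1
    ring

/-- The elementary tensor with prescribed blocks, as a multilinear map in the blocks. -/
noncomputable def blockT (A : Type*) [AddCommGroup A] {N B m : ℕ} (h : N * B = m) :
    MultilinearMap ℤ (fun _ : Fin B => Tp A N) (Tp A m) :=
  ((flattenE A N B).trans (tcast h)).toLinearMap.compMultilinearMap (PiTensorProduct.tprod ℤ)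

lemma iterate_sigmaT_blockT {A : Type*} [AddCommGroup A] {N B m : ℕ} [NeZero N] [NeZero B]
    [NeZero m] (h : N * B = m) (g : Fin B) (u : Fin B → Tp A N) :
    (⇑(sigmaT A m))^[N * g] (blockT A h u) = blockT A h fun b => u (b - g) := by
  have key : (((sigmaT A m).toLinearMap ^ (N * g.val) : Module.End ℤ (Tp A m)).compMultilinearMap
      (blockT A h))
      = (blockT A h).domDomCongr (Equiv.subRight g) := by
    refine MultilinearMap.ext_of_span_eq_top
      (g := fun _ => (PiTensorProduct.tprod ℤ : MultilinearMap ℤ (fun _ : Fin N => A) _))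
      (fun _ => PiTensorProduct.span_tprod_eq_top) fun w => ?_
    subst h
    have hN : 0 < N := NeZero.pos N
    let f : ℕ → A := fun j => w (Fin.ofNat B (j / N)) (Fin.ofNat N j)
    have hval : ∀ (c : ℕ) (r : Fin N), f (N * c + r) = w (Fin.ofNat B c) r := by
      intro c r
      have h1 : (N * c + r) / N = c := by
        rw [Nat.mul_add_div hN, Nat.div_eq_of_lt r.isLt, add_zero]
      have h2 : Fin.ofNat N (N * c + r) = r := by
        ext
        simp [Nat.mod_eq_of_lt r.isLt]
      simp only [f, h1, h2]
    have hf : Function.Periodic f (N * B) := by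
      intro j
      have h1 : (j + N * B) / N = j / N + B := Nat.add_mul_div_left j B hN
      have h2 : Fin.ofNat B (j / N + B) = Fin.ofNat B (j / N) := by ext; simp
      have h3 : Fin.ofNat N (j + N * B) = Fin.ofNat N j := by ext; simp
      simp only [f, h1, h2, h3]
    have hblock : ∀ f : ℕ → A, blockT A (rfl : N * B = N * B) (fun b => PiTensorProduct.tprod ℤ
        fun r : Fin N => f (N * b + r)) = PiTensorProduct.tprod ℤ fun j : Fin (N * B) => f j := by
      intro f
      simp only [blockT, tcast, TensorPower.cast_refl]
      exact flattenE_tprod N B f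
    have hw : (fun b => PiTensorProduct.tprod ℤ (w b))
        = fun b : Fin B => PiTensorProduct.tprod ℤ fun r : Fin N => f (N * b + r) := by
      simp only [hval, Fin.ofNat_val_eq_self]
    have hw' : (fun b => PiTensorProduct.tprod ℤ (w (b - g)))
        = fun b : Fin B => PiTensorProduct.tprod ℤ fun r : Fin N =>
          f (N * b + r + N * (B - g)) := by
      funext b
      congr 1
      funext r
      rw [show N * b.val + r + N * (B - g) = N * (b + (B - g)) + r by ring, hval]
      congr 1
      ext
      simp [Fin.sub_def, add_comm]
    rw [LinearMap.compMultilinearMap_apply, Module.End.pow_apply,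
      MultilinearMap.domDomCongr_apply]
    simp only [Equiv.subRight_apply]
    rw [hw, hw', hblock, hblock fun j => f (j + N * (B - g))]
    refine iterate_sigmaT_tprod (N * B) (N * g) f hf (N * (B - g)) ⟨1, ?_⟩
    rw [← mul_add, Nat.add_sub_cancel' g.isLt.le, mul_one]
  have := DFunLike.congr_fun key u
  rwa [LinearMap.compMultilinearMap_apply, Module.End.pow_apply] at this

lemma sum_iterate_mul {V : Type*} [AddCommGroup V] (T : Module.End ℤ V) (N B : ℕ) (y : V) :
    ∑ l ∈ Finset.range N, T^[l] (∑ g : Fin B, T^[N * g] y)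
      = ∑ s ∈ Finset.range (N * B), T^[s] y := by
  rw [Finset.sum_range fun s => T^[s] y, Finset.sum_range, mul_comm N B]
  rw [← finProdFinEquiv.sum_comp, Fintype.sum_prod_type_right]
  refine Finset.sum_congr rfl fun l _ => ?_
  rw [← Module.End.pow_apply, map_sum]
  refine Finset.sum_congr rfl fun g _ => ?_
  rw [Module.End.pow_apply, ← Function.iterate_add_apply]
  rfl

open scoped Pointwise in
/-- Expand `(p • x + a')^{⊗p^k}` over subsets of the blocks and group the terms by orbits of the
cyclic rotation of the blocks. -/
lemma sum_sigmaT_tpowTo_sub_mem {p k N m : ℕ} (hp : p.Prime) [NeZero N] [NeZero m]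
    {A : Type*} [AddCommGroup A] (h : N * p ^ k = m) (a a' : Tp A N)
    (hdvd : ∃ x : Tp A N, a - a' = p • x) :
    (∑ l ∈ Finset.range N, (⇑(sigmaT A m))^[l] (tpowTo a (p ^ k) h))
      - (∑ l ∈ Finset.range N, (⇑(sigmaT A m))^[l] (tpowTo a' (p ^ k) h))
      ∈ Set.range (normT A m) := by
  obtain ⟨x, hx⟩ := hdvd
  obtain rfl : a = p • x + a' := by rw [← hx, sub_add_cancel]
  have : NeZero p := ⟨hp.ne_zero⟩
  let Φ := blockT A h
  let v : Finset (Fin (p ^ k)) → Tp A m := fun S =>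
    Φ (S.piecewise (fun _ => x) (fun _ => a'))
  let c : Finset (Fin (p ^ k)) → ℕ := fun S => if S = ∅ then 0 else p ^ S.card
  obtain ⟨d, hd⟩ := exists_sum_vadd_eq (G := Fin (p ^ k)) c
    (fun g S => by simp [c]) (fun S => by
      by_cases hS : S = ∅
      · simp [c, hS]
      · simpa only [c, if_neg hS] using card_stabilizer_dvd_pow_card (k := k) hp
          (Nat.card_fin _) S (Finset.nonempty_iff_ne_empty.2 hS)) v
  let T : Module.End ℤ (Tp A m) := (sigmaT A m).toLinearMap
  have hT : ⇑T = ⇑(sigmaT A m) := rfl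
  have hv : ∀ (g : Fin (p ^ k)) S, T^[N * g] (v S) = v (g +ᵥ S) := by
    intro g S
    rw [hT]
    refine (iterate_sigmaT_blockT h g _).trans ?_
    congr 1
    funext b
    simp only [Finset.piecewise, ← Finset.neg_vadd_mem_iff, vadd_eq_add]
    simp [sub_eq_neg_add]
  have hexp : tpowTo (p • x + a') (p ^ k) h - tpowTo a' (p ^ k) h = ∑ S, c S • v S := by
    have h1 : tpowTo (p • x + a') (p ^ k) h
        = ∑ S : Finset (Fin (p ^ k)), p ^ S.card • v S := by
      refine ((blockT A h).map_add_univ (fun _ => p • x) (fun _ => a')).trans ?_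
      refine Finset.sum_congr rfl fun S _ => ?_
      have := Φ.map_piecewise_smul (fun _ => (p : ℤ)) (S.piecewise (fun _ => x) (fun _ => a')) S
      rw [Finset.prod_const, ← Nat.cast_pow, Nat.cast_smul_eq_nsmul] at this
      rw [← this]
      congr 1
      funext b
      by_cases hb : b ∈ S <;> simp [hb]
    have h2 : tpowTo a' (p ^ k) h = v ∅ := by simp [v]; rfl
    rw [h1, h2, ← Finset.add_sum_erase _ _ (Finset.mem_univ ∅),
      ← Finset.add_sum_erase _ (fun S => c S • v S) (Finset.mem_univ ∅)]
    simp only [c, if_true, Finset.card_empty, pow_zero, one_smul, zero_smul, zero_add,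
      add_sub_cancel_left]
    refine Finset.sum_congr rfl fun S hS => ?_
    rw [if_neg (by simpa using hS)]
  refine ⟨∑ S, d S • v S, ?_⟩
  rw [normT, ← hT, ← Finset.sum_sub_distrib]
  subst h
  rw [← sum_iterate_mul]
  refine Finset.sum_congr rfl fun l _ => ?_
  rw [← Module.End.pow_apply, ← Module.End.pow_apply, ← Module.End.pow_apply, ← map_sub, hexp,
    ← hd]
  congr 1
  refine Finset.sum_congr rfl fun g _ => ?_
  rw [← Module.End.pow_apply, map_sum]
  refine Finset.sum_congr rfl fun S _ => ?_
  rw [map_nsmul, Module.End.pow_apply, hv]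

/-- let `p` be a prime, `A` an abelian group, `n ≥ 1` and `0 ≤ i ≤ n − 1`.
If `a, a' ∈ A^{⊗p^i}` satisfy `a − a' = p·x` for some `x`, then
`Σ_{l=0}^{p^i-1} σ_n^l(a^{⊗p^{n-i}}) − Σ_{l=0}^{p^i-1} σ_n^l(a'^{⊗p^{n-i}})` lies in the
image of the norm map `N_{p^n}` on `A^{⊗p^n}`. -/
theorem statement14 (p : ℕ) [NeZero p] (hp : p.Prime) (A : Type*) [AddCommGroup A]
    (n i : ℕ) (hn : 1 ≤ n) (hi : i ≤ n - 1) (a a' : Tp A (p ^ i))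
    (hdvd : ∃ x : Tp A (p ^ i), a - a' = p • x) :
    (∑ l ∈ Finset.range (p ^ i), (⇑(sigmaT A (p ^ n)))^[l]
        (tpowTo a (p ^ (n - i))
          (show p ^ i * p ^ (n - i) = p ^ n by
            rw [← pow_add, Nat.add_sub_cancel' (le_trans hi (Nat.sub_le n 1))])))
      - (∑ l ∈ Finset.range (p ^ i), (⇑(sigmaT A (p ^ n)))^[l]
        (tpowTo a' (p ^ (n - i))
          (show p ^ i * p ^ (n - i) = p ^ n by
            rw [← pow_add, Nat.add_sub_cancel' (le_trans hi (Nat.sub_le n 1))])))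
      ∈ Set.range (normT A (p ^ n)) := by
  exact sum_sigmaT_tpowTo_sub_mem hp _ a a' hdvd
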